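/- Let f : R → σ⁻¹R be a universally σ-inverting ring homomorphism. Let M be a left R-module which is σ-local, i.e. for every s : P → Q in σ, composition with s gives a bijection Hom_R(Q, M) → Hom_R(P, M). Then the R-module structure of M extends uniquely to a left σ⁻¹R-module structure: there is exactly one left σ⁻¹R-module structure on the underlying additive group of M whose restriction along f is the given R-module structure. -/

import Mathlib

open MulOpposite

universe u

section BTensorCore

variable (R : Type u) [Ring R]
variable (M : Type u) [AddCommGroup M] [Module Rᵐᵒᵖ M]
variable (N : Type u) [AddCommGroup N] [Module R N]

/-- The subgroup of relations defining the balanced tensor product `M ⊗_R N`. -/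
noncomputable def btRel : AddSubgroup (TensorProduct ℤ M N) :=
  AddSubgroup.closure
    { x | ∃ (m : M) (r : R) (n : N), x = (op r • m) ⊗ₜ[ℤ] n - m ⊗ₜ[ℤ] (r • n) }

/-- The balanced tensor product `M ⊗_R N` of a right `R`-module `M` and a left `R`-module `N`:
the quotient of `M ⊗_ℤ N` by the relations `(m · r) ⊗ n = m ⊗ (r · n)`. -/
abbrev BTensor : Type u := TensorProduct ℤ M N ⧸ btRel R M N

variable {R M N}

/-- The image of `m ⊗ n` in `M ⊗_R N`. -/
noncomputable def BTensor.tmul (m : M) (n : N) : BTensor R M N :=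
  QuotientAddGroup.mk (m ⊗ₜ[ℤ] n)

variable {A : Type u} [AddCommGroup A]

/-- Lift a balanced biadditive map `M → N → A` to `M ⊗_R N → A`. -/
noncomputable def BTensor.lift (b : M →+ N →+ A)
    (hb : ∀ (r : R) (m : M) (n : N), b (op r • m) n = b m (r • n)) :
    BTensor R M N →+ A :=
  QuotientAddGroup.lift (btRel R M N)
    (TensorProduct.liftAddHom b (fun z m n => by
      simp [map_zsmul]))
    ((AddSubgroup.closure_le _).mpr (by
      rintro y ⟨m, r, n, rfl⟩
      simp [AddMonoidHom.mem_ker, hb r m n]))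

/-- Lift a balanced biadditive map given as a bare function. -/
noncomputable def BTensor.lift' (b : M → N → A)
    (h1 : ∀ m m' n, b (m + m') n = b m n + b m' n)
    (h2 : ∀ m n n', b m (n + n') = b m n + b m n')
    (hb : ∀ (r : R) m n, b (op r • m) n = b m (r • n)) :
    BTensor R M N →+ A :=
  BTensor.lift (AddMonoidHom.mk' (fun m => AddMonoidHom.mk' (b m) (h2 m))
    (fun m m' => AddMonoidHom.ext fun n => h1 m m' n)) hb

section MapRight

variable {N' : Type u} [AddCommGroup N'] [Module R N']

/-- The map `1 ⊗ g : M ⊗_R N → M ⊗_R N'` induced by a map `g` of left `R`-modules. -/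
noncomputable def BTensor.mapRight (g : N →ₗ[R] N') : BTensor R M N →+ BTensor R M N' :=
  QuotientAddGroup.map _ _
    (TensorProduct.map (LinearMap.id (R := ℤ) (M := M)) g.toAddMonoidHom.toIntLinearMap).toAddMonoidHom
    ((AddSubgroup.closure_le _).mpr (by
      rintro y ⟨m, r, n, rfl⟩
      refine AddSubgroup.mem_comap.mpr (AddSubgroup.subset_closure ?_)
      exact ⟨m, r, g n, by simp⟩))

end MapRight

section MapLeft

variable {M' : Type u} [AddCommGroup M'] [Module Rᵐᵒᵖ M']

/-- The map `g ⊗ 1 : M ⊗_R N → M' ⊗_R N` induced by a map `g` of right `R`-modules. -/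
noncomputable def BTensor.mapLeft (g : M →ₗ[Rᵐᵒᵖ] M') : BTensor R M N →+ BTensor R M' N :=
  QuotientAddGroup.map _ _
    (TensorProduct.map g.toAddMonoidHom.toIntLinearMap (LinearMap.id (R := ℤ) (M := N))).toAddMonoidHom
    ((AddSubgroup.closure_le _).mpr (by
      rintro y ⟨m, r, n, rfl⟩
      refine AddSubgroup.mem_comap.mpr (AddSubgroup.subset_closure ?_)
      exact ⟨g m, r, n, by simp⟩))

end MapLeft

end BTensorCore
section Localization

variable {R : Type u} [Ring R] {ι : Type u}
  {P Q : ι → Type u}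
  [∀ i, AddCommGroup (P i)] [∀ i, Module R (P i)]
  [∀ i, AddCommGroup (Q i)] [∀ i, Module R (Q i)]

/-- A ring homomorphism `f : R → S`, together with a right `R`-module structure on `S`, is
`σ`-inverting if the right `R`-action on `S` is the one induced by `f` (i.e. `x • r = x * f r`)
and, for every `s i : P i → Q i` in `σ`, the induced map
`1 ⊗ s i : S ⊗_R P i → S ⊗_R Q i` is bijective. -/
def IsInvertingHom (s : ∀ i, P i →ₗ[R] Q i) (S : Type u) [Ring S] [Module Rᵐᵒᵖ S]
    (f : R →+* S) : Prop :=
  (∀ (r : R) (x : S), op r • x = x * f r) ∧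
    ∀ i, Function.Bijective (BTensor.mapRight (M := S) (s i))

/-- `f : R → S` is universally `σ`-inverting if it is `σ`-inverting and every `σ`-inverting
ring homomorphism `g : R → T` factors through `f` by a unique ring homomorphism `S → T`. -/
def IsUniversalInverting (s : ∀ i, P i →ₗ[R] Q i) (S : Type u) [Ring S] [Module Rᵐᵒᵖ S]
    (f : R →+* S) : Prop :=
  IsInvertingHom s S f ∧
    ∀ (T : Type u) (_ : Ring T) (_ : Module Rᵐᵒᵖ T) (g : R →+* T),
      IsInvertingHom s T g → ∃! h : S →+* T, g = h.comp f

section Auxiliary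

theorem exists_dualBasis_of_finite_of_projective (R P : Type*) [Ring R] [AddCommGroup P]
    [Module R P] [Module.Finite R P] [Module.Projective R P] :
    ∃ (n : ℕ) (b : Fin n → P) (c : Fin n → P →ₗ[R] R), ∀ p, ∑ j, c j p • b j = p := by
  obtain ⟨n, a, d, -, -, had⟩ := Module.Finite.exists_comp_eq_id_of_projective R P
  refine ⟨n, fun j => a (Pi.single j 1), fun j => LinearMap.proj j ∘ₗ d, fun p => ?_⟩
  conv_rhs => rw [← LinearMap.id_apply (R := R) p, ← had, LinearMap.comp_apply,
    pi_eq_sum_univ' (d p)]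
  simp only [map_sum, map_smul, LinearMap.comp_apply, LinearMap.proj_apply]

namespace BTensor

variable {R : Type u} [Ring R]
  {M : Type u} [AddCommGroup M] [Module Rᵐᵒᵖ M]
  {N : Type u} [AddCommGroup N] [Module R N]

theorem op_smul_tmul (r : R) (m : M) (n : N) :
    tmul (R := R) (op r • m) n = tmul m (r • n) :=
  (QuotientAddGroup.eq_iff_sub_mem).mpr (AddSubgroup.subset_closure ⟨m, r, n, rfl⟩)

theorem tmul_add (m : M) (n n' : N) :
    tmul (R := R) m (n + n') = tmul m n + tmul m n' := by
  simp only [tmul, TensorProduct.tmul_add, QuotientAddGroup.mk_add]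

theorem add_tmul (m m' : M) (n : N) :
    tmul (R := R) (m + m') n = tmul m n + tmul m' n := by
  simp only [tmul, TensorProduct.add_tmul, QuotientAddGroup.mk_add]

theorem tmul_sum {κ : Type*} (t : Finset κ) (m : M) (n : κ → N) :
    tmul (R := R) m (∑ j ∈ t, n j) = ∑ j ∈ t, tmul m (n j) :=
  map_sum (AddMonoidHom.mk' (fun x => tmul (R := R) m x) (tmul_add m)) n t

theorem sum_tmul {κ : Type*} (t : Finset κ) (m : κ → M) (n : N) :
    tmul (R := R) (∑ j ∈ t, m j) n = ∑ j ∈ t, tmul (m j) n :=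
  map_sum (AddMonoidHom.mk' (fun x => tmul (R := R) x n) (add_tmul · · n)) m t

theorem addMonoidHom_ext {A : Type*} [AddCommGroup A] {a b : BTensor R M N →+ A}
    (h : ∀ m n, a (tmul m n) = b (tmul m n)) : a = b := by
  refine QuotientAddGroup.addMonoidHom_ext _ (AddMonoidHom.ext fun x => ?_)
  induction x with
  | zero => simp
  | add x y hx hy => simp only [map_add, hx, hy]
  | tmul m n => exact h m n

/-- If `T` is a ring under `R` and `s : P → Q` is a map of finitely generated projective modules
inducing a bijection `Hom(Q, T) → Hom(P, T)`, then `1 ⊗ s : T ⊗ P → T ⊗ Q` is bijective. -/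
theorem bijective_mapRight_of_bijective_comp {T P Q : Type u} [Ring T] [Module Rᵐᵒᵖ T]
    [Module R T] [AddCommGroup P] [Module R P] [AddCommGroup Q] [Module R Q]
    [Module.Finite R P] [Module.Projective R P] [Module.Finite R Q] [Module.Projective R Q]
    (g : R →+* T) (hright : ∀ (r : R) (x : T), op r • x = x * g r)
    (hleft : ∀ (r : R) (x : T), r • x = g r * x) (s : P →ₗ[R] Q)
    (hs : Function.Bijective fun φ : Q →ₗ[R] T => φ.comp s) :
    Function.Bijective (mapRight (M := T) s) := by
  obtain ⟨n, b, c, hbc⟩ := exists_dualBasis_of_finite_of_projective R P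
  obtain ⟨k, b', c', hbc'⟩ := exists_dualBasis_of_finite_of_projective R Q
  let γ : R →ₗ[R] T := { g with map_smul' := fun r x => by simp [hleft] }
  choose ψ hψ using fun j => hs.surjective (γ.comp (c j))
  have hψs (j : Fin n) (p : P) : ψ j (s p) = g (c j p) := LinearMap.congr_fun (hψ j) p
  have hθ (l : Fin k) (q : Q) : ∑ j, ψ j q * g (c' l (s (b j))) = g (c' l q) := by
    let θ : Q →ₗ[R] T :=
      { toFun := fun q => ∑ j, ψ j q * g (c' l (s (b j)))
        map_add' := fun x y => by simp [add_mul, Finset.sum_add_distrib]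
        map_smul' := fun r x => by simp [hleft, mul_assoc, Finset.mul_sum] }
    have h : θ = γ.comp (c' l) := hs.injective <| LinearMap.ext fun p => by
      change ∑ j, ψ j (s p) * g (c' l (s (b j))) = g (c' l (s p))
      conv_rhs => rw [← hbc p]
      simp [hψs]
    exact LinearMap.congr_fun h q
  let β : BTensor R T Q →+ BTensor R T P :=
    lift' (fun t q => ∑ j, tmul (t * ψ j q) (b j))
      (fun t t' q => by simp only [add_mul, add_tmul, Finset.sum_add_distrib])
      (fun t q q' => by simp only [map_add, mul_add, add_tmul, Finset.sum_add_distrib])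
      (fun r t q => by simp only [hright, map_smul, hleft, mul_assoc])
  have hβ (t : T) (q : Q) : β (tmul t q) = ∑ j, tmul (t * ψ j q) (b j) := rfl
  have hmap (t : T) (p : P) : mapRight (M := T) s (tmul t p) = tmul t (s p) := rfl
  refine Function.bijective_iff_has_inverse.mpr ⟨β, fun x => ?_, fun x => ?_⟩
  · refine DFunLike.congr_fun (addMonoidHom_ext (a := β.comp (mapRight s))
      (b := AddMonoidHom.id _) fun t p => ?_) x
    simp only [AddMonoidHom.comp_apply, AddMonoidHom.id_apply, hmap, hβ, hψs, ← hright,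
      op_smul_tmul, ← tmul_sum, hbc]
  · refine DFunLike.congr_fun (addMonoidHom_ext (a := (mapRight s).comp β)
      (b := AddMonoidHom.id _) fun t q => ?_) x
    simp only [AddMonoidHom.comp_apply, AddMonoidHom.id_apply, hβ, map_sum, hmap]
    calc ∑ j, tmul (R := R) (t * ψ j q) (s (b j))
        = ∑ j, ∑ l, tmul (t * (ψ j q * g (c' l (s (b j))))) (b' l) :=
          Finset.sum_congr rfl fun j _ => by
            conv_lhs => rw [← hbc' (s (b j))]
            simp only [tmul_sum, ← op_smul_tmul, hright, mul_assoc]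
      _ = ∑ l, tmul (t * g (c' l q)) (b' l) := by
          rw [Finset.sum_comm]
          simp only [← sum_tmul, ← Finset.mul_sum, hθ]
      _ = tmul t q := by
          simp only [← hright, op_smul_tmul, ← tmul_sum, hbc']

end BTensor

theorem bijective_comp_addMonoidEnd {R P Q M : Type*} [Ring R] [AddCommGroup P] [Module R P]
    [AddCommGroup Q] [Module R Q] [AddCommGroup M] [Module R M] (s : P →ₗ[R] Q)
    (hs : Function.Bijective fun φ : Q →ₗ[R] M => φ.comp s) :
    Function.Bijective fun φ : Q →ₗ[R] (M →+ M) => φ.comp s := by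
  let ev (m : M) : (M →+ M) →ₗ[R] M :=
    { toFun := fun x => x m, map_add' := fun _ _ => rfl, map_smul' := fun _ _ => rfl }
  refine ⟨fun φ φ' h => ?_, fun φ => ?_⟩
  · refine LinearMap.ext fun q => AddMonoidHom.ext fun m => ?_
    refine LinearMap.congr_fun (f := (ev m).comp φ) (g := (ev m).comp φ')
      (hs.injective (LinearMap.ext fun p => ?_)) q
    exact DFunLike.congr_fun (LinearMap.congr_fun h p) m
  · choose ψ hψ using fun m => hs.surjective ((ev m).comp φ)
    have hψs (m : M) (p : P) : ψ m (s p) = φ p m := LinearMap.congr_fun (hψ m) p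
    have hadd (m m' : M) : ψ (m + m') = ψ m + ψ m' :=
      hs.injective (LinearMap.ext fun p => by simp [hψs])
    refine ⟨
      { toFun := fun q => AddMonoidHom.mk' (fun m => ψ m q) fun m m' => by simp [hadd]
        map_add' := fun x y => by ext; simp
        map_smul' := fun r x => by ext; simp }, ?_⟩
    ext p m
    exact hψs m p

end Auxiliary

/-- If `f : R → σ⁻¹R` is universally `σ`-inverting and `M` is a `σ`-local left `R`-module
(i.e. composition with each `s : P → Q` in `σ` is a bijection `Hom_R(Q, M) → Hom_R(P, M)`),
then the `R`-module structure of `M` extends uniquely to a left `σ⁻¹R`-module structure: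
there is exactly one `σ⁻¹R`-module structure on `M` whose restriction along `f` is the given
`R`-module structure. -/
theorem existsUnique_module_extension_of_sigmaLocal
    (s : ∀ i, P i →ₗ[R] Q i)
    (hPfin : ∀ i, Module.Finite R (P i)) (hPproj : ∀ i, Module.Projective R (P i))
    (hQfin : ∀ i, Module.Finite R (Q i)) (hQproj : ∀ i, Module.Projective R (Q i))
    (S : Type u) [Ring S] [Module Rᵐᵒᵖ S] (f : R →+* S)
    (huniv : IsUniversalInverting s S f)
    (M : Type u) [AddCommGroup M] [Module R M]
    (hM : ∀ i, Function.Bijective (fun g : Q i →ₗ[R] M => g.comp (s i))) :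
    ∃! _inst : Module S M, ∀ (r : R) (m : M),
      (letI := _inst; (f r • m : M)) = r • m := by
  let g : R →+* AddMonoid.End M := Module.toAddMonoidEnd R M
  let _ : Module Rᵐᵒᵖ (AddMonoid.End M) := Module.compHom _ g.op
  let _ : Module R (AddMonoid.End M) := inferInstanceAs (Module R (M →+ M))
  have hg : IsInvertingHom s (AddMonoid.End M) g :=
    ⟨fun _ _ => rfl, fun i =>
      have := hPfin i
      have := hPproj i
      have := hQfin i
      have := hQproj i
      BTensor.bijective_mapRight_of_bijective_comp g (fun _ _ => rfl) (fun _ _ => rfl) (s i)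
        (bijective_comp_addMonoidEnd (s i) (hM i))⟩
  obtain ⟨h, hh, huniq⟩ := huniv.2 _ _ _ g hg
  refine ⟨Module.compHom M h, fun r m => ?_, fun inst hinst => ?_⟩
  · exact (DFunLike.congr_fun (DFunLike.congr_fun hh r) m).symm
  · have key : @Module.toAddMonoidEnd S M _ _ inst = h :=
      huniq _ (RingHom.ext fun r => AddMonoidHom.ext fun m => (hinst r m).symm)
    exact Module.ext' _ _ fun x m => DFunLike.congr_fun (DFunLike.congr_fun key x) m

end Localization
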